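/- arXiv:2302.06538 — 5 statements merged into one kernel-verified Lean document; each statement's English description precedes it below -/
import Mathlib

section
/- Let n ≥ 1, let σ : Fin n → Fin n → ℝ satisfy σ i j = σ j i for all i, j, and let λ : Fin n → ℝ satisfy λ i > 0 for all i. Then equality ∑_{i,j} (σ i j)² · (λ i) · (λ j) = (1/n) · (∑_i (σ i i) · (λ i))² holds if and only if σ i j = 0 for all i ≠ j and there exists α ∈ ℝ with (σ i i) · (λ i) = α for every i. -/
open Finset

/-- The weighted squared distance from `σ` to the diagonal array with entries `c / w i`. -/
theorem sum_sq_sub_diagonal_mul_weights {ι : Type*} [Fintype ι] [DecidableEq ι]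
    (σ : ι → ι → ℝ) (w : ι → ℝ) (hw : ∀ i, w i ≠ 0) (c : ℝ) :
    ∑ i, ∑ j, (σ i j - if i = j then c / w i else 0) ^ 2 * (w i * w j) =
      (∑ i, ∑ j, σ i j ^ 2 * w i * w j) - 2 * c * (∑ i, σ i i * w i) +
        Fintype.card ι * c ^ 2 := by
  have entry : ∀ i j, (σ i j - if i = j then c / w i else 0) ^ 2 * (w i * w j) =
      σ i j ^ 2 * w i * w j + if i = j then c ^ 2 - 2 * c * (σ i i * w i) else 0 := by
    intro i j
    split_ifs with h
    · subst h
      have := hw i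
      field_simp
      ring
    · ring
  simp only [entry, sum_add_distrib, sum_ite_eq, mem_univ, if_true, sum_sub_distrib, ← mul_sum,
    sum_const, card_univ, nsmul_eq_mul]
  ring

theorem trace_BK_sq_eq_n_HK_sq_iff_umbilical
    (n : ℕ) (hn : 1 ≤ n)
    (σ : Fin n → Fin n → ℝ) (hσ : ∀ i j, σ i j = σ j i)
    (lam : Fin n → ℝ) (hlam : ∀ i, 0 < lam i) :
    (∑ i, ∑ j, (σ i j) ^ 2 * lam i * lam j) =
      (1 / (n : ℝ)) * (∑ i, σ i i * lam i) ^ 2 ↔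
    (∀ i j, i ≠ j → σ i j = 0) ∧ (∃ α : ℝ, ∀ i, σ i i * lam i = α) := by
  have hn0 : (n : ℝ) ≠ 0 := by positivity
  have key := sum_sq_sub_diagonal_mul_weights σ lam (fun i => (hlam i).ne')
  simp only [Fintype.card_fin] at key
  constructor
  · intro h
    set c := (∑ i, σ i i * lam i) / n with hc
    have hzero : ∑ i, ∑ j, (σ i j - if i = j then c / lam i else 0) ^ 2 *
        (lam i * lam j) = 0 := by
      rw [key, h, hc]
      field_simp
      ring
    have hnonneg : ∀ i j, 0 ≤ (σ i j - if i = j then c / lam i else 0) ^ 2 *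
        (lam i * lam j) := fun i j =>
      mul_nonneg (sq_nonneg _) (mul_pos (hlam i) (hlam j)).le
    have hentry : ∀ i j, σ i j = if i = j then c / lam i else 0 := by
      intro i j
      have hrow := (sum_eq_zero_iff_of_nonneg
        fun i _ => sum_nonneg fun j _ => hnonneg i j).1 hzero i (mem_univ i)
      have hij := (sum_eq_zero_iff_of_nonneg fun j _ => hnonneg i j).1 hrow j (mem_univ j)
      have hpos := mul_pos (hlam i) (hlam j)
      exact sub_eq_zero.1 (pow_eq_zero_iff two_ne_zero |>.1
        ((mul_eq_zero.1 hij).resolve_right hpos.ne'))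
    refine ⟨fun i j hij => by simpa [hij] using hentry i j, c, fun i => ?_⟩
    rw [hentry i i, if_pos rfl, div_mul_cancel₀ _ (hlam i).ne']
  · rintro ⟨hoff, α, hα⟩
    have hentry : ∀ i j, (σ i j - if i = j then α / lam i else 0) = 0 := by
      intro i j
      split_ifs with h
      · subst h
        rw [← hα i, mul_div_cancel_right₀ _ (hlam i).ne', sub_self]
      · rw [hoff i j h, sub_zero]
    have hsum := key α
    simp only [hentry, hα, sum_const, card_univ, Fintype.card_fin, nsmul_eq_mul] at hsum ⊢
    field_simp
    norm_num at hsum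
    linear_combination -hsum
end

section
/- Let n ≥ 1 and let P, B be n×n real matrices with P positive definite (P.PosDef) and B symmetric (B.IsSymm). Then n · trace((P·B)·(P·B)) ≥ (trace(P·B))². -/
/-- Cauchy–Schwarz for the trace of a symmetric matrix. -/
theorem Matrix.IsSymm.sq_trace_le {ι : Type*} [Fintype ι] {S : Matrix ι ι ℝ} (hS : S.IsSymm) :
    S.trace ^ 2 ≤ Fintype.card ι * (S * S).trace := by
  calc S.trace ^ 2 ≤ Fintype.card ι * ∑ i, S i i ^ 2 := sq_sum_le_card_mul_sum_sq
    _ ≤ Fintype.card ι * (S * S).trace := by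
      refine mul_le_mul_of_nonneg_left (Finset.sum_le_sum fun i _ => ?_) (Nat.cast_nonneg _)
      simp only [diag_apply, mul_apply, fun j => hS.apply i j, ← sq]
      exact Finset.single_le_sum (f := fun j => S i j ^ 2) (fun j _ => sq_nonneg _)
        (Finset.mem_univ i)

theorem matrix_trace_sq_ineq
    (n : ℕ) (hn : 1 ≤ n)
    (P B : Matrix (Fin n) (Fin n) ℝ)
    (hP : P.PosDef) (hB : B.IsSymm) :
    (n : ℝ) * ((P * B) * (P * B)).trace ≥ ((P * B).trace) ^ 2 := by
  obtain ⟨C, rfl⟩ : ∃ C : Matrix (Fin n) (Fin n) ℝ, P = C.transpose * C := by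
    open scoped MatrixOrder in
    simpa [Matrix.star_eq_conjTranspose] using
      CStarAlgebra.nonneg_iff_eq_star_mul_self.mp hP.posSemidef.nonneg
  have hS : (C * B * C.transpose).IsSymm := by
    simp [Matrix.IsSymm, Matrix.transpose_mul, hB.eq, Matrix.mul_assoc]
  have h₁ : (C.transpose * C * B).trace = (C * B * C.transpose).trace := by
    rw [Matrix.mul_assoc, Matrix.trace_mul_comm]
  have h₂ : (C.transpose * C * B * (C.transpose * C * B)).trace =
      (C * B * C.transpose * (C * B * C.transpose)).trace := by
    simp only [Matrix.mul_assoc]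
    rw [Matrix.trace_mul_comm]
    simp only [Matrix.mul_assoc]
  rw [h₁, h₂]
  simpa using hS.sq_trace_le
end

section
/- Let n ≥ 1 and let P, B be n×n real matrices with P positive definite (P.PosDef) and B symmetric (B.IsSymm). Then n · trace((P·B)·(P·B)) = (trace(P·B))² if and only if P·B = (trace(P·B)/n) • 1, i.e. P·B is the scalar matrix with factor trace(P·B)/n. -/
open Matrix in
/-- Equality case of the Cauchy–Schwarz inequality `(tr S)² ≤ n · tr (S²)` for symmetric `S`. -/
theorem Matrix.IsSymm.eq_smul_one_of_card_mul_trace_sq_eq {ι : Type*} [Fintype ι] [DecidableEq ι]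
    [Nonempty ι] {S : Matrix ι ι ℝ} (hS : S.IsSymm)
    (h : (Fintype.card ι : ℝ) * (S * S).trace = S.trace ^ 2) :
    S = (S.trace / Fintype.card ι) • (1 : Matrix ι ι ℝ) := by
  have hn : (Fintype.card ι : ℝ) ≠ 0 := Nat.cast_ne_zero.mpr Fintype.card_ne_zero
  set c := S.trace / Fintype.card ι with hc
  have hD : (S - c • (1 : Matrix ι ι ℝ))ᴴ = S - c • (1 : Matrix ι ι ℝ) := by
    simp [conjTranspose_eq_transpose_of_trivial, hS.eq]
  rw [← sub_eq_zero, ← trace_conjTranspose_mul_self_eq_zero_iff, hD]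
  simp only [sub_mul, mul_sub, smul_mul_assoc, mul_smul_comm, one_mul, mul_one, trace_sub,
    trace_smul, trace_one, smul_eq_mul]
  have h' : (S * S).trace = S.trace ^ 2 / Fintype.card ι := by
    rw [eq_div_iff hn, mul_comm, h]
  rw [h', hc]
  field_simp
  ring

open scoped MatrixOrder Matrix.Norms.L2Operator in
open Matrix in
theorem Matrix.PosDef.exists_isUnit_eq_transpose_mul_self {ι : Type*} [Fintype ι] [DecidableEq ι]
    {P : Matrix ι ι ℝ} (hP : P.PosDef) : ∃ C : Matrix ι ι ℝ, IsUnit C ∧ P = Cᵀ * C :=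
  CStarAlgebra.isStrictlyPositive_iff_eq_star_mul_self.mp hP.isStrictlyPositive

open Matrix in
theorem matrix_trace_sq_eq_iff_scalar
    (n : ℕ) (hn : 1 ≤ n)
    (P B : Matrix (Fin n) (Fin n) ℝ)
    (hP : P.PosDef) (hB : B.IsSymm) :
    (n : ℝ) * ((P * B) * (P * B)).trace = ((P * B).trace) ^ 2 ↔
      P * B = (((P * B).trace) / (n : ℝ)) • (1 : Matrix (Fin n) (Fin n) ℝ) := by
  have hn0 : (n : ℝ) ≠ 0 := Nat.cast_ne_zero.mpr (by lia)
  have : Nonempty (Fin n) := ⟨⟨0, hn⟩⟩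
  constructor
  · intro h
    obtain ⟨C, hC, rfl⟩ := hP.exists_isUnit_eq_transpose_mul_self
    have hS : (C * B * Cᵀ).IsSymm := by
      simp [IsSymm, transpose_mul, hB.eq, Matrix.mul_assoc]
    have htr : (C * B * Cᵀ).trace = (Cᵀ * C * B).trace := by
      rw [trace_mul_comm, ← Matrix.mul_assoc]
    have htr2 : (C * B * Cᵀ * (C * B * Cᵀ)).trace = (Cᵀ * C * B * (Cᵀ * C * B)).trace := by
      rw [← Matrix.mul_assoc, trace_mul_comm]
      simp only [Matrix.mul_assoc]
    have hscalar := hS.eq_smul_one_of_card_mul_trace_sq_eq (by simpa [htr, htr2] using h)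
    rw [htr, Fintype.card_fin] at hscalar
    refine (show IsUnit Cᵀ from hC.star).mul_right_cancel ?_
    calc Cᵀ * C * B * Cᵀ = Cᵀ * (C * B * Cᵀ) := by simp only [Matrix.mul_assoc]
      _ = _ := by rw [hscalar]; simp
  · intro h
    generalize (P * B).trace = t at h ⊢
    rw [h]
    simp
    field_simp
end

section
/- In the boundary-angle setup, assume φ_K > 0 and ⟨N_K, ξ⟩ = 0. Then cos θ ≠ 0 and ν_K = (φ_K / cos θ)·ξ. -/
open scoped RealInnerProductSpace

theorem anisotropic_conormal_along_free_boundary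
    {E : Type*} [NormedAddCommGroup E] [InnerProductSpace ℝ E]
    (ν N : E) (hν : ‖ν‖ = 1) (hN : ‖N‖ = 1) (horth : ⟪ν, N⟫ = 0)
    (θ : ℝ) (ξ μ : E)
    (hξ : ξ = Real.cos θ • ν + Real.sin θ • N)
    (hμ : μ = -(Real.sin θ) • ν + Real.cos θ • N)
    (N_K : E) (φ_K : ℝ) (hφ : φ_K = ⟪N_K, N⟫)
    (ν_K : E) (hνK : ν_K = φ_K • ν - ⟪N_K, ν⟫ • N)
    (hφpos : 0 < φ_K) (hfree : ⟪N_K, ξ⟫ = 0) :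
    Real.cos θ ≠ 0 ∧ ν_K = (φ_K / Real.cos θ) • ξ := by
  rw [hξ, inner_add_right, inner_smul_right, inner_smul_right, ← hφ] at hfree
  have hcos : Real.cos θ ≠ 0 := by
    intro hc
    have hs : Real.sin θ = 0 := by simpa [hc, hφpos.ne'] using hfree
    simpa [hc, hs] using Real.sin_sq_add_cos_sq θ
  have hcoef : -⟪N_K, ν⟫ = φ_K / Real.cos θ * Real.sin θ := by
    field_simp
    linarith
  refine ⟨hcos, ?_⟩
  rw [hνK, hξ, smul_add, smul_smul, smul_smul, div_mul_cancel₀ _ hcos, ← hcoef, neg_smul,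
    sub_eq_add_neg]
end

section
/- Let n ∈ ℕ, H ∈ ℝ, and let A, V : ℝ → ℝ be twice continuously differentiable at 0 (ContDiffAt ℝ 2 at 0) with V(0) ≠ 0, A(0) = −(n+1)·H·V(0), V'(0) = A(0), and A'(0) = −n·H·A(0). Define λ(t) = (V(0)/V(t))^{1/(n+1)} (real power) and a(t) = λ(t)ⁿ·A(t). Then a is twice differentiable at 0 and a''(0) = A''(0) + n·H²·A(0) + n·H·V''(0). -/
theorem hasDerivAt_rescale_mul {c q v b t : ℝ} {n : ℕ} {V B : ℝ → ℝ}
    (hV : HasDerivAt V v t) (hB : HasDerivAt B b t) (hpos : 0 < c / V t) :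
    HasDerivAt (fun s => ((c / V s) ^ q) ^ n * B s)
      (((c / V t) ^ q) ^ n * (b - n * q * (v * B t / V t))) t := by
  have hVt : V t ≠ 0 := fun h => by simp [h] at hpos
  have hc : c ≠ 0 := fun h => by simp [h] at hpos
  have hdiv := (hasDerivAt_const t c).fun_div hV hVt
  have hmul := ((hdiv.rpow_const (p := q) (Or.inl hpos.ne')).fun_pow n).fun_mul hB
  refine hmul.congr_deriv ?_
  rw [Real.rpow_sub_one hpos.ne']
  rcases n with _ | n
  · simp
  · simp only [Nat.add_sub_cancel]
    field_simp
    ring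

theorem ContDiffAt.differentiableAt_deriv {f : ℝ → ℝ} {x : ℝ} (hf : ContDiffAt ℝ 2 f x) :
    DifferentiableAt ℝ (deriv f) x :=
  ((hf.fderiv_right (m := 1) (by norm_num)).clm_apply contDiffAt_const).differentiableAt
    (by norm_num)

theorem second_derivative_rescaled_area
    (n : ℕ) (H : ℝ) (A V : ℝ → ℝ)
    (hA : ContDiffAt ℝ 2 A 0) (hV : ContDiffAt ℝ 2 V 0)
    (hV0 : V 0 ≠ 0)
    (hAV : A 0 = -((n : ℝ) + 1) * H * V 0)
    (hV' : deriv V 0 = A 0)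
    (hA' : deriv A 0 = -(n : ℝ) * H * A 0) :
    DifferentiableAt ℝ
        (fun t : ℝ => ((V 0 / V t) ^ ((1 : ℝ) / ((n : ℝ) + 1))) ^ n * A t) 0 ∧
    DifferentiableAt ℝ
        (deriv (fun t : ℝ => ((V 0 / V t) ^ ((1 : ℝ) / ((n : ℝ) + 1))) ^ n * A t)) 0 ∧
    deriv (deriv (fun t : ℝ => ((V 0 / V t) ^ ((1 : ℝ) / ((n : ℝ) + 1))) ^ n * A t)) 0 =
      deriv (deriv A) 0 + (n : ℝ) * H ^ 2 * A 0 + (n : ℝ) * H * deriv (deriv V) 0 := by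
  set q : ℝ := (1 : ℝ) / ((n : ℝ) + 1) with hq
  have hpos : ∀ᶠ t in nhds (0 : ℝ), 0 < V 0 / V t := by
    refine (continuousAt_const.div hV.continuousAt hV0).eventually (lt_mem_nhds ?_)
    simp [hV0]
  have hder : ∀ᶠ t in nhds (0 : ℝ),
      HasDerivAt (fun t : ℝ => ((V 0 / V t) ^ q) ^ n * A t)
        (((V 0 / V t) ^ q) ^ n * (deriv A t - n * q * (deriv V t * A t / V t))) t := by
    filter_upwards [hpos, hA.eventually (by simp), hV.eventually (by simp)] with t ht hAt hVt
    exact hasDerivAt_rescale_mul (hVt.differentiableAt (by norm_num)).hasDerivAt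
      (hAt.differentiableAt (by norm_num)).hasDerivAt ht
  have hA1 := (hA.differentiableAt (by norm_num)).hasDerivAt
  have hV1 := (hV.differentiableAt (by norm_num)).hasDerivAt
  have hA2 := hA.differentiableAt_deriv.hasDerivAt
  have hV2 := hV.differentiableAt_deriv.hasDerivAt
  have hB := hA2.fun_sub (((hV2.fun_mul hA1).fun_div hV1 hV0).const_mul ((n : ℝ) * q))
  have hsecond := (hasDerivAt_rescale_mul (q := q) (n := n) hV1 hB
    hpos.self_of_nhds).congr_of_eventuallyEq (hder.mono fun t ht => ht.deriv)
  refine ⟨hder.self_of_nhds.differentiableAt, hsecond.differentiableAt, ?_⟩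
  have hn : (n : ℝ) + 1 ≠ 0 := by positivity
  rw [hsecond.deriv, div_self hV0, Real.one_rpow, one_pow, hV', hA', hAV, hq]
  field_simp
  ring
end
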